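/- arXiv:1602.02461 — 2 statements merged into one kernel-verified Lean document; each statement's English description precedes it below -/
import Mathlib

section
/- Let G be a finite simple graph containing a triangle with vertex set X = {x₁, x₂, x₃}. Suppose (a) |H_2(G) \ X| − |L_2(G) \ X| ≥ 2, and (b) every vertex v of G outside X has at most 2 neighbors in X. Then G contains two vertex-disjoint cycles. -/
open Finset

/-- `G` contains `k` pairwise vertex-disjoint cycles. -/
def HasDisjointCycles {V : Type*} (G : SimpleGraph V) (k : ℕ) : Prop :=
  ∃ (v : Fin k → V) (c : ∀ i, G.Walk (v i) (v i)),
    (∀ i, (c i).IsCycle) ∧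
    ∀ i j, i ≠ j → ∀ x, x ∈ (c i).support → x ∉ (c j).support

/-- `H_k(G)`: the set of vertices of degree at least `2k`. -/
def Hset {V : Type*} [Fintype V] (G : SimpleGraph V) [DecidableRel G.Adj] (k : ℕ) : Finset V :=
  univ.filter fun v => 2 * k ≤ G.degree v

/-- `L_k(G)`: the set of vertices of degree at most `2k - 2`. -/
def Lset {V : Type*} [Fintype V] (G : SimpleGraph V) [DecidableRel G.Adj] (k : ℕ) : Finset V :=
  univ.filter fun v => G.degree v ≤ 2 * k - 2

namespace SimpleGraph

variable {V : Type*} {G : SimpleGraph V}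

/-- Some cycle of `G` has all its vertices in `U`. -/
def HasCycleIn (G : SimpleGraph V) (U : Finset V) : Prop :=
  ∃ (v : V) (c : G.Walk v v), c.IsCycle ∧ ∀ x ∈ c.support, x ∈ U

/-- Any two vertices of `A` are joined by a walk of `G` inside `A`. -/
def ConnectedOn (G : SimpleGraph V) (A : Finset V) : Prop :=
  ∀ a ∈ A, ∀ b ∈ A, ∃ p : G.Walk a b, ∀ x ∈ p.support, x ∈ A

lemma HasCycleIn.mono {U U' : Finset V} (h : G.HasCycleIn U) (hU : U ⊆ U') : G.HasCycleIn U' := by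
  obtain ⟨v, c, hc, hs⟩ := h
  exact ⟨v, c, hc, fun x hx => hU (hs x hx)⟩

lemma HasCycleIn.hasDisjointCycles {U U' : Finset V} (h : G.HasCycleIn U) (h' : G.HasCycleIn U')
    (hd : Disjoint U U') : HasDisjointCycles G 2 := by
  obtain ⟨v, c, hc, hs⟩ := h
  obtain ⟨v', c', hc', hs'⟩ := h'
  let w : Fin 2 → Σ v, G.Walk v v := ![⟨v, c⟩, ⟨v', c'⟩]
  rw [Finset.disjoint_left] at hd
  refine ⟨fun i => (w i).1, fun i => (w i).2, ?_, ?_⟩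
  · rw [Fin.forall_fin_two]
    exact ⟨hc, hc'⟩
  · simp only [Fin.forall_fin_two]
    refine ⟨⟨fun h => absurd rfl h, fun _ x hx hx' => hd (hs x hx) (hs' x hx')⟩,
      fun _ x hx hx' => hd (hs x hx') (hs' x hx), fun h => absurd rfl h⟩

/-- A walk avoiding `x` between two distinct neighbours of `x` closes up to a cycle. -/
lemma Walk.hasCycleIn [DecidableEq V] {A : Finset V} {u v x : V} (p : G.Walk u v)
    (hp : ∀ y ∈ p.support, y ∈ A) (hx : x ∉ p.support) (huv : u ≠ v)
    (hu : G.Adj x u) (hv : G.Adj x v) : G.HasCycleIn (insert x A) := by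
  have hq : ∀ y ∈ p.bypass.support, y ∈ p.support := fun y hy => p.support_bypass_subset_support hy
  have hpath : (p.bypass.concat hv.symm).IsPath :=
    p.bypass_isPath.concat (fun h => hx (hq _ h)) hv.symm
  refine ⟨x, Walk.cons hu (p.bypass.concat hv.symm), ?_, ?_⟩
  · rw [Walk.cons_isCycle_iff]
    refine ⟨hpath, fun he => ?_⟩
    rw [Walk.edges_concat, List.concat_eq_append, List.mem_append] at he
    rcases he with he | he
    · exact hx (hq _ (Walk.fst_mem_support_of_mem_edges _ he))
    · simp only [List.mem_singleton, Sym2.eq_iff] at he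
      rcases he with ⟨h1, -⟩ | ⟨-, h2⟩
      · exact hv.ne h1
      · exact huv h2
  · intro y hy
    simp only [Walk.support_cons, Walk.support_concat, List.mem_cons,
      List.mem_append, List.not_mem_nil, or_false] at hy
    rcases hy with rfl | hy | rfl
    · simp
    · exact Finset.mem_insert_of_mem (hp _ (hq _ hy))
    · simp

lemma ConnectedOn.hasCycleIn [DecidableEq V] {A : Finset V} (hA : G.ConnectedOn A) {u v x : V}
    (hx : x ∉ A) (hu : u ∈ A) (hv : v ∈ A) (huv : u ≠ v) (hxu : G.Adj x u) (hxv : G.Adj x v) :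
    G.HasCycleIn (insert x A) := by
  obtain ⟨p, hp⟩ := hA u hu v hv
  exact p.hasCycleIn hp (fun h => hx (hp _ h)) huv hxu hxv

lemma hasCycleIn_triangle [DecidableEq V] {x y z : V} (hxy : G.Adj x y) (hxz : G.Adj x z)
    (hyz : G.Adj y z) : G.HasCycleIn {x, y, z} := by
  refine (Walk.cons hyz Walk.nil).hasCycleIn (A := {y, z}) ?_ ?_ hyz.ne hxy hxz
  · simp
  · simp [hxy.ne, hxz.ne]

/-- A walk from inside to outside of `S` crosses the boundary of `S`. -/
lemma ConnectedOn.exists_boundary {A : Finset V} (hA : G.ConnectedOn A) {S : Finset V} {a b : V}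
    (ha : a ∈ A) (haS : a ∈ S) (hb : b ∈ A) (hbS : b ∉ S) :
    ∃ c ∈ A, c ∈ S ∧ ∃ d ∈ A, d ∉ S ∧ G.Adj c d := by
  obtain ⟨p, hp⟩ := hA a ha b hb
  obtain ⟨d, hd, h1, h2⟩ := p.exists_boundary_dart (S : Set V) haS hbS
  exact ⟨d.fst, hp _ (p.dart_fst_mem_support_of_mem_darts hd), h1, d.snd,
    hp _ (p.dart_snd_mem_support_of_mem_darts hd), h2, d.adj⟩

lemma ConnectedOn.union [DecidableEq V] {A B : Finset V} (hA : G.ConnectedOn A)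
    (hB : G.ConnectedOn B) {a b : V} (ha : a ∈ A) (hb : b ∈ B) (hab : G.Adj a b) :
    G.ConnectedOn (A ∪ B) := by
  have key : ∀ x ∈ A ∪ B, ∃ p : G.Walk x a, ∀ y ∈ p.support, y ∈ A ∪ B := by
    intro x hx
    rcases Finset.mem_union.1 hx with hx | hx
    · obtain ⟨p, hp⟩ := hA x hx a ha
      exact ⟨p, fun y hy => Finset.mem_union_left _ (hp y hy)⟩
    · obtain ⟨p, hp⟩ := hB x hx b hb
      refine ⟨p.concat hab.symm, fun y hy => ?_⟩
      simp only [Walk.support_concat, List.mem_append, List.mem_singleton] at hy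
      rcases hy with hy | rfl
      · exact Finset.mem_union_right _ (hp y hy)
      · exact Finset.mem_union_left _ ha
  intro x hx y hy
  obtain ⟨p, hp⟩ := key x hx
  obtain ⟨q, hq⟩ := key y hy
  refine ⟨p.append q.reverse, fun z hz => ?_⟩
  rw [Walk.mem_support_append_iff, Walk.support_reverse, List.mem_reverse] at hz
  exact hz.elim (hp z) (hq z)

open Classical in
/-- The vertices reachable from `u` by walks inside `U`. -/
noncomputable def reachIn (G : SimpleGraph V) (U : Finset V) (u : V) : Finset V :=
  U.filter fun x => ∃ p : G.Walk u x, ∀ y ∈ p.support, y ∈ U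

lemma mem_reachIn {U : Finset V} {u x : V} :
    x ∈ G.reachIn U u ↔ ∃ p : G.Walk u x, ∀ y ∈ p.support, y ∈ U := by
  simp only [reachIn, Finset.mem_filter, and_iff_right_iff_imp]
  rintro ⟨p, hp⟩
  exact hp _ p.end_mem_support

lemma reachIn_subset (G : SimpleGraph V) (U : Finset V) (u : V) : G.reachIn U u ⊆ U := by
  classical exact Finset.filter_subset _ _

lemma mem_reachIn_self {U : Finset V} {u : V} (hu : u ∈ U) : u ∈ G.reachIn U u :=
  mem_reachIn.2 ⟨Walk.nil, by simpa using hu⟩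

lemma mem_reachIn_symm {U : Finset V} {u x : V} (h : x ∈ G.reachIn U u) : u ∈ G.reachIn U x := by
  obtain ⟨p, hp⟩ := mem_reachIn.1 h
  exact mem_reachIn.2 ⟨p.reverse, by simpa using hp⟩

lemma mem_reachIn_trans {U : Finset V} {u x y : V} (h : x ∈ G.reachIn U u)
    (h' : y ∈ G.reachIn U x) : y ∈ G.reachIn U u := by
  obtain ⟨p, hp⟩ := mem_reachIn.1 h
  obtain ⟨q, hq⟩ := mem_reachIn.1 h'
  refine mem_reachIn.2 ⟨p.append q, fun z hz => ?_⟩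
  rw [Walk.mem_support_append_iff] at hz
  exact hz.elim (hp z) (hq z)

lemma mem_reachIn_of_adj {U : Finset V} {u x y : V} (h : x ∈ G.reachIn U u) (hy : y ∈ U)
    (hxy : G.Adj x y) : y ∈ G.reachIn U u := by
  refine mem_reachIn_trans h (mem_reachIn.2 ⟨Walk.cons hxy Walk.nil, ?_⟩)
  simp [hy, reachIn_subset G U u h]

lemma reachIn_eq {U : Finset V} {u x : V} (h : x ∈ G.reachIn U u) :
    G.reachIn U x = G.reachIn U u := by
  ext y
  exact ⟨mem_reachIn_trans h, mem_reachIn_trans (mem_reachIn_symm h)⟩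

lemma connectedOn_reachIn (G : SimpleGraph V) (U : Finset V) (u : V) :
    G.ConnectedOn (G.reachIn U u) := by
  classical
  intro a ha b hb
  rw [← reachIn_eq ha] at hb
  obtain ⟨p, hp⟩ := mem_reachIn.1 hb
  refine ⟨p, fun x hx => mem_reachIn_trans ha (mem_reachIn.2 ⟨p.takeUntil x hx, fun y hy => ?_⟩)⟩
  exact hp y (p.support_takeUntil_subset_support hx hy)

/-- A positive sum over `U` is positive on some component of `U`. -/
lemma exists_reachIn_sum_pos {U : Finset V} {w : V → ℤ} (h : 0 < ∑ x ∈ U, w x) :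
    ∃ u ∈ U, 0 < ∑ x ∈ G.reachIn U u, w x := by
  classical
  by_contra! hcon
  rw [← Finset.sum_fiberwise_of_maps_to (t := U.image (G.reachIn U)) (g := G.reachIn U)
    (fun x hx => Finset.mem_image_of_mem _ hx)] at h
  refine h.not_ge (Finset.sum_nonpos fun C hC => ?_)
  obtain ⟨u, hu, rfl⟩ := Finset.mem_image.1 hC
  convert hcon u hu using 2
  ext x
  simp only [Finset.mem_filter]
  constructor
  · rintro ⟨hx, he⟩
    exact he ▸ mem_reachIn_self hx
  · intro hx
    exact ⟨reachIn_subset G U u hx, reachIn_eq hx⟩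

lemma isTree_induce {A : Finset V} (hA : G.ConnectedOn A) (hne : A.Nonempty)
    (hcyc : ¬ G.HasCycleIn A) : (G.induce (A : Set V)).IsTree := by
  obtain ⟨a, ha⟩ := hne
  have : Nonempty (A : Set V) := ⟨⟨a, ha⟩⟩
  refine ⟨⟨fun x y => ?_⟩, fun v c hc => hcyc ?_⟩
  · obtain ⟨p, hp⟩ := hA x x.2 y y.2
    exact ⟨p.induce (A : Set V) hp⟩
  · let φ := Embedding.induce (G := G) (A : Set V)
    refine ⟨φ.toHom v, c.map φ.toHom, hc.map φ.injective, fun x hx => ?_⟩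
    rw [Walk.support_map, List.mem_map] at hx
    obtain ⟨y, -, rfl⟩ := hx
    exact y.2

lemma sum_card_adj_filter [DecidableEq V] [DecidableRel G.Adj] {A : Finset V}
    (hA : G.ConnectedOn A) (hne : A.Nonempty) (hcyc : ¬ G.HasCycleIn A) :
    ∑ v ∈ A, #{u ∈ A | G.Adj v u} + 2 = 2 * #A := by
  have hT := (isTree_induce hA hne hcyc).card_edgeFinset
  have hs := (G.induce (A : Set V)).sum_degrees_eq_twice_card_edges
  have hcard : Fintype.card (A : Set V) = #A := by simp
  have hdeg : ∑ v : (A : Set V), (G.induce (A : Set V)).degree v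
      = ∑ v ∈ A, #{u ∈ A | G.Adj v u} := by
    rw [← Finset.sum_coe_sort A]
    refine Finset.sum_congr rfl fun v _ => ?_
    rw [← card_neighborFinset_eq_degree]
    refine Finset.card_bij (fun x _ => x.1) ?_ ?_ ?_
    · intro x hx
      rw [mem_neighborFinset] at hx
      exact Finset.mem_filter.2 ⟨x.2, hx⟩
    · intro x _ y _ h
      exact Subtype.ext h
    · intro y hy
      rw [Finset.mem_filter] at hy
      exact ⟨⟨y, hy.1⟩, by rw [mem_neighborFinset]; exact hy.2, rfl⟩
  omega

/-- Choosing a neighbour of every vertex of a tree, some edge is chosen from both of its ends. -/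
lemma exists_mutual_choice {A : Finset V} (hA : G.ConnectedOn A) (hne : A.Nonempty)
    (hcyc : ¬ G.HasCycleIn A) {f : V → V} (hf : ∀ v ∈ A, f v ∈ A ∧ G.Adj v (f v)) :
    ∃ v ∈ A, f (f v) = v := by
  classical
  have hT := (isTree_induce hA hne hcyc).card_edgeFinset
  let g : ((A : Set V) : Type _) → Sym2 (A : Set V) := fun v => s(v, ⟨f v, (hf v v.2).1⟩)
  have hlt : #(G.induce (A : Set V)).edgeFinset < #(Finset.univ : Finset (A : Set V)) := by
    rw [Finset.card_univ]
    omega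
  obtain ⟨x, -, y, -, hxy, he⟩ := Finset.exists_ne_map_eq_of_card_lt_of_maps_to (f := g) hlt
    (fun v _ => by
      rw [Finset.mem_coe, mem_edgeFinset, mem_edgeSet]
      exact (hf v v.2).2)
  simp only [g, Sym2.eq_iff] at he
  rcases he with ⟨h, -⟩ | ⟨h1, h2⟩
  · exact absurd h hxy
  · have h1' : (x : V) = f y := congrArg Subtype.val h1
    have h2' : f x = (y : V) := congrArg Subtype.val h2
    exact ⟨x, x.2, by rw [h2', ← h1']⟩

/-- Given two pairs of vertices in a connected set, some vertex of one pair can be avoided by a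
walk joining the other pair. -/
lemma ConnectedOn.exists_walk_avoiding [DecidableEq V] {D : Finset V} (hD : G.ConnectedOn D)
    {u w v z : V} (hv : v ∈ D) (hz : z ∈ D) (huv : u ≠ v) (huz : u ≠ z) :
    (∃ p : G.Walk v z, (∀ x ∈ p.support, x ∈ D) ∧ (u ∉ p.support ∨ w ∉ p.support)) ∨
      ∃ p : G.Walk u w, (∀ x ∈ p.support, x ∈ D) ∧ (v ∉ p.support ∨ z ∉ p.support) := by
  obtain ⟨p, hp⟩ := hD v hv z hz
  have hb : ∀ x ∈ p.bypass.support, x ∈ D := fun x hx => hp x (p.support_bypass_subset_support hx)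
  have hpath := p.bypass_isPath
  generalize p.bypass = q at hb hpath
  by_cases hu : u ∈ q.support
  swap
  · exact .inl ⟨q, hb, .inl hu⟩
  by_cases hw : w ∈ q.support
  swap
  · exact .inl ⟨q, hb, .inr hw⟩
  right
  by_cases hwd : w ∈ (q.takeUntil u hu).support
  · refine ⟨((q.takeUntil u hu).dropUntil w hwd).reverse, fun x hx => ?_, .inr fun hx => ?_⟩
    all_goals
      rw [Walk.support_reverse, List.mem_reverse] at hx
      have hx' := (q.takeUntil u hu).support_dropUntil_subset_support hwd hx
    · exact hb x (q.support_takeUntil_subset_support hu hx')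
    · exact Walk.endpoint_notMem_support_takeUntil hpath hu huz.symm hx'
  · have hwd' : w ∈ (q.dropUntil u hu).support := by
      have := hw
      rw [← q.take_spec hu, Walk.mem_support_append_iff] at this
      exact this.resolve_left hwd
    refine ⟨(q.dropUntil u hu).takeUntil w hwd', fun x hx => ?_, .inl fun hx => ?_⟩
    all_goals have hx' := (q.dropUntil u hu).support_takeUntil_subset_support hwd' hx
    · exact hb x (q.support_dropUntil_subset_support hu hx')
    · have hnd := hpath.support_nodup
      rw [← q.take_spec hu, Walk.support_append] at hnd
      have hd := List.disjoint_of_nodup_append hnd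
      refine hd (Walk.start_mem_support _) ?_
      rw [Walk.mem_support_iff] at hx'
      exact hx'.resolve_left huv.symm

section Triangle

variable {X : Finset V}

/-- `t` is a vertex of `X` such that `p` is adjacent to all other vertices of `X`. -/
def MissesOnly (G : SimpleGraph V) (X : Finset V) (p t : V) : Prop :=
  t ∈ X ∧ ∀ y ∈ X, y ≠ t → G.Adj p y

lemma exists_missesOnly [DecidableRel G.Adj] (hX : #X = 3) {p : V}
    (hp : #{x ∈ X | G.Adj p x} = 2) :
    ∃ t, G.MissesOnly X p t := by
  have h1 : #{x ∈ X | ¬ G.Adj p x} = 1 := by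
    have := Finset.card_filter_add_card_filter_not (s := X) (fun x => G.Adj p x)
    omega
  obtain ⟨t, ht⟩ := Finset.card_eq_one.1 h1
  have hmem : ∀ y, y ∈ X ∧ ¬ G.Adj p y ↔ y = t := fun y => by
    rw [← Finset.mem_singleton, ← ht, Finset.mem_filter]
  refine ⟨t, ((hmem t).2 rfl).1, fun y hy hyt => ?_⟩
  by_contra h
  exact hyt ((hmem y).1 ⟨hy, h⟩)

lemma exists_pair_missesOnly [DecidableRel G.Adj] (hX : #X = 3)
    {A : Finset V} (h : 2 ≤ #{v ∈ A | #{x ∈ X | G.Adj v x} = 2}) :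
    ∃ u ∈ A, ∃ v ∈ A, u ≠ v ∧ (∃ t, G.MissesOnly X u t) ∧ ∃ t, G.MissesOnly X v t := by
  obtain ⟨u, hu, v, hv, huv⟩ := Finset.one_lt_card.1 h
  rw [Finset.mem_filter] at hu hv
  exact ⟨u, hu.1, v, hv.1, huv, exists_missesOnly hX hu.2, exists_missesOnly hX hv.2⟩

variable [DecidableEq V]

/-- The two remaining vertices of a three-element set. -/
lemma exists_others (hX : #X = 3) {x : V} (hx : x ∈ X) :
    ∃ y z, y ≠ z ∧ y ≠ x ∧ z ≠ x ∧ X = {x, y, z} := by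
  have h : #(X.erase x) = 2 := by rw [Finset.card_erase_of_mem hx, hX]
  obtain ⟨y, z, hyz, he⟩ := Finset.card_eq_two.1 h
  have hy : y ∈ X.erase x := he ▸ by simp
  have hz : z ∈ X.erase x := he ▸ by simp
  refine ⟨y, z, hyz, Finset.ne_of_mem_erase hy, Finset.ne_of_mem_erase hz, ?_⟩
  rw [← he, Finset.insert_erase hx]

lemma exists_mem_ne_ne (hX : #X = 3) (a b : V) : ∃ x ∈ X, x ≠ a ∧ x ≠ b := by
  have h : 0 < #(X \ {a, b}) := by
    have h1 := Finset.le_card_sdiff {a, b} X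
    have h2 : #{a, b} ≤ 2 := Finset.card_le_two
    omega
  obtain ⟨x, hx⟩ := Finset.card_pos.1 h
  simp only [Finset.mem_sdiff, Finset.mem_insert, Finset.mem_singleton, not_or] at hx
  exact ⟨x, hx⟩

lemma hasDisjointCycles_of_walk_avoiding (hX : #X = 3)
    (hXc : ∀ x ∈ X, ∀ y ∈ X, x ≠ y → G.Adj x y) {D : Finset V} (hD : Disjoint D X)
    {p a b tp ta tb : V} (hp : G.MissesOnly X p tp) (ha : G.MissesOnly X a ta)
    (hb : G.MissesOnly X b tb) (q : G.Walk a b) (hq : ∀ x ∈ q.support, x ∈ D)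
    (hpq : p ∉ q.support) (hpX : p ∉ X) (hab : a ≠ b) (hta : ta ≠ tp) (htb : tb ≠ tp) :
    HasDisjointCycles G 2 := by
  rw [Finset.disjoint_left] at hD
  obtain ⟨y, z, hyz, hy, hz, rfl⟩ := exists_others hX hp.1
  have h1 : G.HasCycleIn {p, y, z} := hasCycleIn_triangle (hp.2 y (by simp) hy)
    (hp.2 z (by simp) hz) (hXc y (by simp) z (by simp) hyz)
  have h2 : G.HasCycleIn (insert tp (D.erase p)) :=
    q.hasCycleIn (fun x hx => Finset.mem_erase.2 ⟨fun h => hpq (h ▸ hx), hq x hx⟩)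
      (fun h => hD (hq _ h) hp.1) hab (ha.2 tp hp.1 hta.symm).symm (hb.2 tp hp.1 htb.symm).symm
  refine h1.hasDisjointCycles h2 ?_
  rw [Finset.disjoint_left]
  intro x hx hx'
  have hyD : y ∉ D := fun h => hD h (by simp)
  have hzD : z ∉ D := fun h => hD h (by simp)
  have hptp : p ≠ tp := fun h => hpX (h ▸ hp.1)
  simp only [Finset.mem_insert, Finset.mem_singleton, Finset.mem_erase] at hx hx'
  grind

lemma hasDisjointCycles_of_separate {A B : Finset V} (hAX : Disjoint A X) (hBX : Disjoint B X)
    (hAB : Disjoint A B) (hA : G.ConnectedOn A) (hB : G.ConnectedOn B)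
    {u v w z tu tv tw tz x y : V} (hu : u ∈ A) (hv : v ∈ A) (hw : w ∈ B) (hz : z ∈ B)
    (huv : u ≠ v) (hwz : w ≠ z) (mu : G.MissesOnly X u tu) (mv : G.MissesOnly X v tv)
    (mw : G.MissesOnly X w tw) (mz : G.MissesOnly X z tz) (hx : x ∈ X) (hy : y ∈ X)
    (hxy : x ≠ y) (hxu : x ≠ tu) (hxv : x ≠ tv) (hyw : y ≠ tw) (hyz : y ≠ tz) :
    HasDisjointCycles G 2 := by
  rw [Finset.disjoint_left] at hAX hBX
  have h1 := hA.hasCycleIn (fun h => hAX h hx) hu hv huv (mu.2 x hx hxu).symm (mv.2 x hx hxv).symm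
  have h2 := hB.hasCycleIn (fun h => hBX h hy) hw hz hwz (mw.2 y hy hyw).symm (mz.2 y hy hyz).symm
  refine h1.hasDisjointCycles h2 ?_
  rw [Finset.disjoint_left] at hAB ⊢
  intro c hc hc'
  simp only [Finset.mem_insert] at hc hc'
  grind

lemma hasDisjointCycles_of_three_of_two (hX : #X = 3) {A B : Finset V} (hAX : Disjoint A X)
    (hBX : Disjoint B X) (hAB : Disjoint A B) (hA : G.ConnectedOn A) (hB : G.ConnectedOn B)
    {a b c w z ta tb tc tw tz : V} (ha : a ∈ A) (hb : b ∈ A) (hc : c ∈ A) (hw : w ∈ B)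
    (hz : z ∈ B) (hab : a ≠ b) (hac : a ≠ c) (hbc : b ≠ c) (hwz : w ≠ z)
    (ma : G.MissesOnly X a ta) (mb : G.MissesOnly X b tb) (mc : G.MissesOnly X c tc)
    (mw : G.MissesOnly X w tw) (mz : G.MissesOnly X z tz) : HasDisjointCycles G 2 := by
  obtain ⟨y, hy, hyw, hyz⟩ := exists_mem_ne_ne hX tw tz
  obtain ⟨x, x', hxx, hxy, hxy', hXe⟩ := exists_others hX hy
  have hx : x ∈ X := hXe ▸ by simp
  have hx' : x' ∈ X := hXe ▸ by simp
  have key : ∃ s ∈ X, s ≠ y ∧ ((s ≠ ta ∧ s ≠ tb) ∨ (s ≠ ta ∧ s ≠ tc) ∨ (s ≠ tb ∧ s ≠ tc)) := by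
    by_cases h : (x ≠ ta ∧ x ≠ tb) ∨ (x ≠ ta ∧ x ≠ tc) ∨ (x ≠ tb ∧ x ≠ tc)
    · exact ⟨x, hx, hxy, h⟩
    · exact ⟨x', hx', hxy', by grind⟩
  obtain ⟨s, hs, hsy, ⟨h1, h2⟩ | ⟨h1, h2⟩ | ⟨h1, h2⟩⟩ := key
  · exact hasDisjointCycles_of_separate hAX hBX hAB hA hB ha hb hw hz hab hwz ma mb mw mz hs hy
      hsy h1 h2 hyw hyz
  · exact hasDisjointCycles_of_separate hAX hBX hAB hA hB ha hc hw hz hac hwz ma mc mw mz hs hy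
      hsy h1 h2 hyw hyz
  · exact hasDisjointCycles_of_separate hAX hBX hAB hA hB hb hc hw hz hbc hwz mb mc mw mz hs hy
      hsy h1 h2 hyw hyz

lemma hasDisjointCycles_of_two_pairs (hX : #X = 3)
    (hXc : ∀ x ∈ X, ∀ y ∈ X, x ≠ y → G.Adj x y) {D : Finset V} (hD : Disjoint D X)
    (hDc : G.ConnectedOn D) {u w v z i j : V} (hu : u ∈ D) (hw : w ∈ D) (hv : v ∈ D) (hz : z ∈ D)
    (huw : u ≠ w) (hvz : v ≠ z) (hij : i ≠ j) (mu : G.MissesOnly X u i) (mw : G.MissesOnly X w i)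
    (mv : G.MissesOnly X v j) (mz : G.MissesOnly X z j) (huv : u ≠ v) (huz : u ≠ z) :
    HasDisjointCycles G 2 := by
  have hD' := Finset.disjoint_left.1 hD
  obtain ⟨p, hp, h | h⟩ | ⟨p, hp, h | h⟩ := hDc.exists_walk_avoiding hv hz huv huz
  · exact hasDisjointCycles_of_walk_avoiding hX hXc hD mu mv mz p hp h (hD' hu) hvz hij.symm
      hij.symm
  · exact hasDisjointCycles_of_walk_avoiding hX hXc hD mw mv mz p hp h (hD' hw) hvz hij.symm
      hij.symm
  · exact hasDisjointCycles_of_walk_avoiding hX hXc hD mv mu mw p hp h (hD' hv) huw hij hij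
  · exact hasDisjointCycles_of_walk_avoiding hX hXc hD mz mu mw p hp h (hD' hz) huw hij hij

lemma hasDisjointCycles_of_adj (hX : #X = 3) (hXc : ∀ x ∈ X, ∀ y ∈ X, x ≠ y → G.Adj x y)
    {A B : Finset V} (hAX : Disjoint A X) (hBX : Disjoint B X) (hAB : Disjoint A B)
    (hA : G.ConnectedOn A) (hB : G.ConnectedOn B) {a b : V} (ha : a ∈ A) (hb : b ∈ B)
    (hab : G.Adj a b) {u v w z tu tv tw tz : V} (hu : u ∈ A) (hv : v ∈ A) (hw : w ∈ B)
    (hz : z ∈ B) (huv : u ≠ v) (hwz : w ≠ z) (mu : G.MissesOnly X u tu)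
    (mv : G.MissesOnly X v tv) (mw : G.MissesOnly X w tw) (mz : G.MissesOnly X z tz) :
    HasDisjointCycles G 2 := by
  by_contra hno
  have hsep : ∀ x ∈ X, ∀ y ∈ X, x ≠ y → x ≠ tu → x ≠ tv → y ≠ tw → y ≠ tz → False :=
    fun x hx y hy hxy h1 h2 h3 h4 => hno <| hasDisjointCycles_of_separate hAX hBX hAB hA hB hu hv
      hw hz huv hwz mu mv mw mz hx hy hxy h1 h2 h3 h4
  have hne : ∀ c ∈ A, ∀ d ∈ B, c ≠ d := fun c hc d hd h =>
    Finset.disjoint_left.1 hAB hc (h ▸ hd)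
  obtain ⟨x, hx, hxu, hxv⟩ := exists_mem_ne_ne hX tu tv
  obtain ⟨y, hy, hyw, hyz⟩ := exists_mem_ne_ne hX tw tz
  have hxy : x = y := by
    by_contra h
    exact hsep x hx y hy h hxu hxv hyw hyz
  subst hxy
  obtain ⟨i, j, hij, hix, hjx, hXe⟩ := exists_others hX hx
  have hi : i ∈ X := hXe ▸ by simp
  have hj : j ∈ X := hXe ▸ by simp
  have two : ∀ t ∈ X, t ≠ x → t = i ∨ t = j := fun t ht htx => by
    rw [hXe] at ht
    simpa [htx] using ht
  have hu' := two tu mu.1 hxu.symm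
  have hv' := two tv mv.1 hxv.symm
  have hw' := two tw mw.1 hyw.symm
  have hz' := two tz mz.1 hyz.symm
  have huv' : tu ≠ tv := fun h => by
    have h1 := hsep i hi x hx hix
    have h2 := hsep j hj x hx hjx
    grind
  have hwz' : tw ≠ tz := fun h => by
    have h1 := hsep x hx i hi hix.symm
    have h2 := hsep x hx j hj hjx.symm
    grind
  have hDX : Disjoint (A ∪ B) X := Finset.disjoint_union_left.2 ⟨hAX, hBX⟩
  have hDc := hA.union hB ha hb hab
  have hA' : ∀ c ∈ A, c ∈ A ∪ B := fun c hc => Finset.mem_union_left _ hc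
  have hB' : ∀ c ∈ B, c ∈ A ∪ B := fun c hc => Finset.mem_union_right _ hc
  apply hno
  by_cases h : tu = tw
  · have h' : tv = tz := by grind
    exact hasDisjointCycles_of_two_pairs hX hXc hDX hDc (hA' u hu) (hB' w hw) (hA' v hv)
      (hB' z hz) (hne u hu w hw) (hne v hv z hz) huv' mu (h ▸ mw) mv (h' ▸ mz) huv
      (hne u hu z hz)
  · have h1 : tu = tz := by grind
    have h2 : tv = tw := by grind
    exact hasDisjointCycles_of_two_pairs hX hXc hDX hDc (hA' u hu) (hB' z hz) (hA' v hv)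
      (hB' w hw) (hne u hu z hz) (hne v hv w hw) huv' mu (h1 ▸ mz) mv (h2 ▸ mw) huv
      (hne u hu w hw)

end Triangle

section Count

variable [Fintype V] [DecidableRel G.Adj] {X : Finset V}

/-- The contribution of `v` to `|H_2(G)| - |L_2(G)|`. -/
def excess (G : SimpleGraph V) [DecidableRel G.Adj] (v : V) : ℤ :=
  (if 4 ≤ G.degree v then 1 else 0) - (if G.degree v ≤ 2 then 1 else 0)

lemma excess_le_one (v : V) : G.excess v ≤ 1 := by
  unfold excess
  split_ifs <;> omega

lemma degree_eq_add_add [DecidableEq V] {A : Finset V} (hA : A ⊆ Xᶜ) (v : V) :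
    G.degree v = #{u ∈ X | G.Adj v u} + #{u ∈ A | G.Adj v u} + #{u ∈ Xᶜ \ A | G.Adj v u} := by
  have h1 : #{u ∈ A | G.Adj v u} + #{u ∈ Xᶜ \ A | G.Adj v u} = #{u ∈ Xᶜ | G.Adj v u} := by
    rw [← Finset.card_union_of_disjoint
      (Finset.disjoint_filter_filter Finset.disjoint_sdiff), ← Finset.filter_union,
      Finset.union_sdiff_of_subset hA]
  have h2 : #{u ∈ X | G.Adj v u} + #{u ∈ Xᶜ | G.Adj v u} = G.degree v := by
    rw [← Finset.card_union_of_disjoint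
      (Finset.disjoint_filter_filter disjoint_compl_right), ← Finset.filter_union,
      Finset.union_compl, ← card_neighborFinset_eq_degree, neighborFinset_eq_filter]
  omega

/-- In a tree outside `X`, an excess of high-degree vertices forces many vertices with two
neighbours in `X`. -/
lemma sum_excess_add_two_le [DecidableEq V] {A : Finset V}
    (hb : ∀ v ∉ X, #{x ∈ X | G.Adj v x} ≤ 2) (hAX : A ⊆ Xᶜ) (hA : G.ConnectedOn A)
    (hne : A.Nonempty) (hcyc : ¬ G.HasCycleIn A) (hnbr : ∀ v ∈ A, ∃ u ∉ X, G.Adj v u) :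
    ∑ v ∈ A, G.excess v + 2 ≤
      #{v ∈ A | #{x ∈ X | G.Adj v x} = 2} + ∑ v ∈ A, (#{u ∈ Xᶜ \ A | G.Adj v u} : ℤ) := by
  have hloc : ∀ v ∈ A, G.excess v ≤ (if #{x ∈ X | G.Adj v x} = 2 then 1 else 0) +
      (#{u ∈ A | G.Adj v u} : ℤ) + (#{u ∈ Xᶜ \ A | G.Adj v u} : ℤ) - 2 := by
    intro v hv
    have hd := degree_eq_add_add (G := G) hAX v
    have h2 := hb v (Finset.mem_compl.1 (hAX hv))
    have h1 : 1 ≤ #{u ∈ A | G.Adj v u} + #{u ∈ Xᶜ \ A | G.Adj v u} := by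
      obtain ⟨u, hu, huv⟩ := hnbr v hv
      by_cases huA : u ∈ A
      · have : 0 < #{u ∈ A | G.Adj v u} :=
          Finset.card_pos.2 ⟨u, Finset.mem_filter.2 ⟨huA, huv⟩⟩
        omega
      · have : 0 < #{u ∈ Xᶜ \ A | G.Adj v u} := Finset.card_pos.2 ⟨u, Finset.mem_filter.2
          ⟨Finset.mem_sdiff.2 ⟨Finset.mem_compl.2 hu, huA⟩, huv⟩⟩
        omega
    unfold excess
    split_ifs <;> omega
  have hs := Finset.sum_le_sum hloc
  rw [Finset.sum_sub_distrib, Finset.sum_add_distrib, Finset.sum_add_distrib, Finset.sum_boole,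
    Finset.sum_const, nsmul_eq_mul] at hs
  have he : (∑ v ∈ A, (#{u ∈ A | G.Adj v u} : ℤ)) + 2 = 2 * #A := by
    exact_mod_cast sum_card_adj_filter hA hne hcyc
  linarith

variable [DecidableEq V]

/-- A component of `G - X` with positive excess has at least two vertices. -/
lemma exists_adj_of_sum_excess_pos (hb : ∀ v ∉ X, #{x ∈ X | G.Adj v x} ≤ 2) {A : Finset V}
    (hAX : A ⊆ Xᶜ) (hA : G.ConnectedOn A) (hclosed : ∀ a ∈ A, ∀ b ∉ X, G.Adj a b → b ∈ A)
    (hpos : 0 < ∑ v ∈ A, G.excess v) : ∀ v ∈ A, ∃ u ∈ A, G.Adj v u := by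
  intro v hv
  by_contra! hcon
  have hsing : A = {v} := by
    refine Finset.eq_singleton_iff_unique_mem.2 ⟨hv, fun u hu => ?_⟩
    by_contra huv
    obtain ⟨c, -, hc, d, hd, -, hcd⟩ := hA.exists_boundary (S := {v}) hv (by simp) hu (by simpa)
    rw [Finset.mem_singleton] at hc
    exact hcon d hd (hc ▸ hcd)
  have hdeg := degree_eq_add_add (G := G) hAX v
  have h1 : #{u ∈ A | G.Adj v u} = 0 := by
    rw [Finset.card_eq_zero, Finset.filter_eq_empty_iff]
    exact fun u hu => hcon u hu
  have h2 : #{u ∈ Xᶜ \ A | G.Adj v u} = 0 := by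
    rw [Finset.card_eq_zero, Finset.filter_eq_empty_iff]
    intro u hu hvu
    rw [Finset.mem_sdiff, Finset.mem_compl] at hu
    exact hu.2 (hclosed v hv u hu.1 hvu)
  have h3 := hb v (Finset.mem_compl.1 (hAX hv))
  rw [hsing, Finset.sum_singleton, excess] at hpos
  split_ifs at hpos <;> omega

lemma three_le_card_of_sum_excess_pos (hb : ∀ v ∉ X, #{x ∈ X | G.Adj v x} ≤ 2) {A : Finset V}
    (hAX : A ⊆ Xᶜ) (hA : G.ConnectedOn A) (hclosed : ∀ a ∈ A, ∀ b ∉ X, G.Adj a b → b ∈ A)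
    (hcyc : ¬ G.HasCycleIn A) (hpos : 0 < ∑ v ∈ A, G.excess v) :
    3 ≤ #{v ∈ A | #{x ∈ X | G.Adj v x} = 2} := by
  have hadj := exists_adj_of_sum_excess_pos hb hAX hA hclosed hpos
  have hne : A.Nonempty := Finset.nonempty_of_sum_ne_zero hpos.ne'
  have h := sum_excess_add_two_le hb hAX hA hne hcyc fun v hv => by
    obtain ⟨u, hu, hvu⟩ := hadj v hv
    exact ⟨u, Finset.mem_compl.1 (hAX hu), hvu⟩
  have h0 : ∑ v ∈ A, (#{u ∈ Xᶜ \ A | G.Adj v u} : ℤ) = 0 := by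
    refine Finset.sum_eq_zero fun v hv => ?_
    rw [Nat.cast_eq_zero, Finset.card_eq_zero, Finset.filter_eq_empty_iff]
    intro u hu hvu
    rw [Finset.mem_sdiff, Finset.mem_compl] at hu
    exact hu.2 (hclosed v hv u hu.1 hvu)
  omega

/-- If `T` is a tree component of `G - X` with excess at least two and `v ∈ T`, then some branch
of `T` at `v` contains two vertices with two neighbours in `X`. -/
lemma exists_branch (hb : ∀ v ∉ X, #{x ∈ X | G.Adj v x} ≤ 2) {T : Finset V}
    (hTX : T ⊆ Xᶜ) (hT : G.ConnectedOn T) (hclosed : ∀ a ∈ T, ∀ b ∉ X, G.Adj a b → b ∈ T)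
    (hcyc : ¬ G.HasCycleIn T) (hsum : 2 ≤ ∑ v ∈ T, G.excess v) {v : V} (hv : v ∈ T) :
    ∃ u, ∃ C ⊆ T, G.ConnectedOn C ∧ v ∉ C ∧ u ∈ C ∧ G.Adj v u ∧
      (∀ a ∈ C, ∀ b ∈ T, b ∉ C → G.Adj a b → b = v) ∧
      2 ≤ #{v ∈ C | #{x ∈ X | G.Adj v x} = 2} := by
  have herase : 0 < ∑ x ∈ T.erase v, G.excess x := by
    have h1 := Finset.add_sum_erase T G.excess hv
    have h2 := G.excess_le_one v
    omega
  obtain ⟨c, hc, hpos⟩ := exists_reachIn_sum_pos (G := G) herase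
  have hcC : c ∈ G.reachIn (T.erase v) c := mem_reachIn_self hc
  have hCe : G.reachIn (T.erase v) c ⊆ T.erase v := reachIn_subset G _ _
  have hCc : G.ConnectedOn (G.reachIn (T.erase v) c) := connectedOn_reachIn G _ _
  have hbd : ∀ a ∈ G.reachIn (T.erase v) c, ∀ b ∈ T, b ∉ G.reachIn (T.erase v) c →
      G.Adj a b → b = v := by
    intro a ha b hbT hbC hab
    by_contra hbv
    exact hbC (mem_reachIn_of_adj ha (Finset.mem_erase.2 ⟨hbv, hbT⟩) hab)
  generalize G.reachIn (T.erase v) c = C at hpos hcC hCe hCc hbd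
  have hCT : C ⊆ T := hCe.trans (Finset.erase_subset _ _)
  have hvC : v ∉ C := fun h => Finset.ne_of_mem_erase (hCe h) rfl
  obtain ⟨u, -, huC, d, hdT, hdC, hud⟩ := hT.exists_boundary (hCT hcC) hcC hv hvC
  obtain rfl := hbd u huC d hdT hdC hud
  refine ⟨u, C, hCT, hCc, hvC, huC, hud.symm, hbd, ?_⟩
  have hadj := exists_adj_of_sum_excess_pos hb hTX hT hclosed (by omega)
  have h := sum_excess_add_two_le hb (hCT.trans hTX) hCc ⟨u, huC⟩
    (fun h => hcyc (h.mono hCT)) fun a ha => by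
      obtain ⟨e, he, hae⟩ := hadj a (hCT ha)
      exact ⟨e, Finset.mem_compl.1 (hTX he), hae⟩
  have hr : ∑ a ∈ C, (#{b ∈ Xᶜ \ C | G.Adj a b} : ℤ) ≤ ∑ a ∈ C, if a = u then 1 else 0 := by
    refine Finset.sum_le_sum fun a ha => ?_
    have hsub : ∀ b ∈ ({b ∈ Xᶜ \ C | G.Adj a b} : Finset V), b = d := by
      intro b hb'
      rw [Finset.mem_filter, Finset.mem_sdiff, Finset.mem_compl] at hb'
      exact hbd a ha b (hclosed a (hCT ha) b hb'.1.1 hb'.2) hb'.1.2 hb'.2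
    split_ifs with hau
    · exact_mod_cast Finset.card_le_one.2 fun b hb1 b' hb2 => (hsub b hb1).trans (hsub b' hb2).symm
    · rw [Nat.cast_nonpos, Finset.card_eq_zero, Finset.eq_empty_iff_forall_notMem]
      intro b hb'
      have hbd' := hsub b hb'
      have had : G.Adj a d := hbd' ▸ (Finset.mem_filter.1 hb').2
      exact hcyc ((hCc.hasCycleIn hvC ha huC hau had.symm hud.symm).mono
        (Finset.insert_subset hv hCT))
  rw [Finset.sum_ite_eq' C u, if_pos huC] at hr
  omega

/-- The triangle lemma, in terms of the total excess outside the triangle. -/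
lemma hasDisjointCycles_of_two_le_sum_excess (hX : #X = 3)
    (hXc : ∀ x ∈ X, ∀ y ∈ X, x ≠ y → G.Adj x y) (hb : ∀ v ∉ X, #{x ∈ X | G.Adj v x} ≤ 2)
    (hsum : 2 ≤ ∑ v ∈ Xᶜ, G.excess v) : HasDisjointCycles G 2 := by
  by_contra hno
  have hcyc : ∀ A ⊆ Xᶜ, ¬ G.HasCycleIn A := by
    intro A hA h
    obtain ⟨x, y, z, hxy, hxz, hyz, he⟩ := Finset.card_eq_three.1 hX
    have htri : G.HasCycleIn X := by
      rw [he]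
      exact hasCycleIn_triangle (hXc x (by simp [he]) y (by simp [he]) hxy)
        (hXc x (by simp [he]) z (by simp [he]) hxz) (hXc y (by simp [he]) z (by simp [he]) hyz)
    exact hno (htri.hasDisjointCycles h
      (Finset.disjoint_of_subset_right hA disjoint_compl_right))
  have hdisj : ∀ {A : Finset V}, A ⊆ Xᶜ → Disjoint A X := fun hA =>
    Finset.disjoint_of_subset_left hA disjoint_compl_left
  obtain ⟨c, hc, hpos⟩ := exists_reachIn_sum_pos (G := G) (show 0 < ∑ v ∈ Xᶜ, G.excess v by omega)
  have hTX : G.reachIn Xᶜ c ⊆ Xᶜ := reachIn_subset G _ _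
  have hT : G.ConnectedOn (G.reachIn Xᶜ c) := connectedOn_reachIn G _ _
  have hcT : c ∈ G.reachIn Xᶜ c := mem_reachIn_self hc
  have hclosed : ∀ a ∈ G.reachIn Xᶜ c, ∀ b ∉ X, G.Adj a b → b ∈ G.reachIn Xᶜ c :=
    fun a ha b hbX hab => mem_reachIn_of_adj ha (Finset.mem_compl.2 hbX) hab
  generalize G.reachIn Xᶜ c = T at hpos hTX hT hcT hclosed
  have hrest : ∑ v ∈ Xᶜ \ T, G.excess v ≤ 0 := by
    by_contra! hpos'
    obtain ⟨c', hc', hpos'⟩ := exists_reachIn_sum_pos (G := G) hpos'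
    have hsub : G.reachIn (Xᶜ \ T) c' ⊆ Xᶜ \ T := reachIn_subset G _ _
    have hT' : G.ConnectedOn (G.reachIn (Xᶜ \ T) c') := connectedOn_reachIn G _ _
    have hclosed' : ∀ a ∈ G.reachIn (Xᶜ \ T) c', ∀ b ∉ X, G.Adj a b →
        b ∈ G.reachIn (Xᶜ \ T) c' := by
      intro a ha b hbX hab
      have ha' := Finset.mem_sdiff.1 (hsub ha)
      refine mem_reachIn_of_adj ha (Finset.mem_sdiff.2 ⟨Finset.mem_compl.2 hbX, fun hbT => ?_⟩) hab
      exact ha'.2 (hclosed b hbT a (Finset.mem_compl.1 ha'.1) hab.symm)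
    generalize G.reachIn (Xᶜ \ T) c' = T' at hpos' hsub hT' hclosed'
    have hT'X : T' ⊆ Xᶜ := hsub.trans Finset.sdiff_subset
    have h3 := three_le_card_of_sum_excess_pos hb hTX hT hclosed (hcyc T hTX) hpos
    have h3' := three_le_card_of_sum_excess_pos hb hT'X hT' hclosed' (hcyc T' hT'X) hpos'
    obtain ⟨p, hp, q, hq, r, hr, hpq, hpr, hqr⟩ := Finset.two_lt_card.1 h3
    rw [Finset.mem_filter] at hp hq hr
    obtain ⟨w, hw, z, hz, hwz, ⟨tw, mw⟩, tz, mz⟩ :=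
      exists_pair_missesOnly hX (by omega : 2 ≤ #{v ∈ T' | #{x ∈ X | G.Adj v x} = 2})
    obtain ⟨tp, mp⟩ := exists_missesOnly hX hp.2
    obtain ⟨tq, mq⟩ := exists_missesOnly hX hq.2
    obtain ⟨tr, mr⟩ := exists_missesOnly hX hr.2
    exact hno (hasDisjointCycles_of_three_of_two hX (hdisj hTX) (hdisj hT'X)
      (Finset.disjoint_of_subset_right hsub Finset.disjoint_sdiff) hT hT' hp.1 hq.1 hr.1 hw hz
      hpq hpr hqr hwz mp mq mr mw mz)
  have hsumT : 2 ≤ ∑ v ∈ T, G.excess v := by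
    have := Finset.sum_sdiff (f := G.excess) hTX
    omega
  have hbranch := fun v (hv : v ∈ T) =>
    exists_branch hb hTX hT hclosed (hcyc T hTX) hsumT hv
  have : Nonempty V := ⟨c⟩
  choose! f C hCT hCc hvC hfC hadj hbd hcard using hbranch
  obtain ⟨v, hv, hfv⟩ := exists_mutual_choice hT ⟨c, hcT⟩ (hcyc T hTX)
    fun v hv => ⟨hCT v hv (hfC v hv), hadj v hv⟩
  have hu : f v ∈ T := hCT v hv (hfC v hv)
  have hvC' : v ∈ C (f v) := by simpa [hfv] using hfC (f v) hu
  have hdisjC : Disjoint (C v) (C (f v)) := by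
    rw [Finset.disjoint_left]
    intro z hz hz'
    obtain ⟨a, ha', ha, b, hb', hbC, hab⟩ := (hCc (f v) hu).exists_boundary hz' hz hvC' (hvC v hv)
    have hbv : b = v := hbd v hv a ha b (hCT (f v) hu hb') hbC hab
    have hne : a ≠ f v := fun h => hvC (f v) hu (h ▸ ha')
    exact hcyc T hTX (((hCc v hv).hasCycleIn (hvC v hv) ha (hfC v hv) hne (hbv ▸ hab).symm
      (hadj v hv)).mono (Finset.insert_subset hv (hCT v hv)))
  obtain ⟨p, hp, q, hq, hpq, ⟨tp, mp⟩, tq, mq⟩ := exists_pair_missesOnly hX (hcard v hv)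
  obtain ⟨w, hw, z, hz, hwz, ⟨tw, mw⟩, tz, mz⟩ := exists_pair_missesOnly hX (hcard (f v) hu)
  exact hno (hasDisjointCycles_of_adj hX hXc (hdisj ((hCT v hv).trans hTX))
    (hdisj ((hCT (f v) hu).trans hTX)) hdisjC (hCc v hv) (hCc (f v) hu) (hfC v hv) hvC'
    (hadj v hv).symm hp hq hw hz hpq hwz mp mq mw mz)

lemma sum_excess_compl (X : Finset V) :
    ∑ v ∈ Xᶜ, G.excess v = (#(Hset G 2 \ X) : ℤ) - #(Lset G 2 \ X) := by
  simp only [excess, Finset.sum_sub_distrib, Finset.sum_boole]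
  congr 3 <;> ext v <;> simp [Hset, Lset, and_comm]

end Count

end SimpleGraph

theorem triangle_lemma_two_cycles {V : Type*} [Fintype V] [DecidableEq V] (G : SimpleGraph V)
    [DecidableRel G.Adj] (x₁ x₂ x₃ : V)
    (htri : G.Adj x₁ x₂ ∧ G.Adj x₁ x₃ ∧ G.Adj x₂ x₃)
    (ha : ((Lset G 2) \ {x₁, x₂, x₃}).card + 2 ≤ ((Hset G 2) \ {x₁, x₂, x₃}).card)
    (hb : ∀ v : V, v ∉ ({x₁, x₂, x₃} : Finset V) →
      (({x₁, x₂, x₃} : Finset V).filter (fun x => G.Adj v x)).card ≤ 2) :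
    HasDisjointCycles G 2 := by
  obtain ⟨h12, h13, h23⟩ := htri
  refine SimpleGraph.hasDisjointCycles_of_two_le_sum_excess (X := {x₁, x₂, x₃})
    (Finset.card_eq_three.2 ⟨x₁, x₂, x₃, h12.ne, h13.ne, h23.ne, rfl⟩) ?_ hb ?_
  · simp only [Finset.mem_insert, Finset.mem_singleton]
    rintro x (rfl | rfl | rfl) y (rfl | rfl | rfl) hxy <;>
      first | exact absurd rfl hxy | assumption | (apply SimpleGraph.Adj.symm; assumption)
  · rw [SimpleGraph.sum_excess_compl]
    omega
end

section
/- Let k be a positive integer and G a triangle-free finite simple graph with at least one vertex. If |V_{≥2k+1}(G)| − |V_{≤2k−1}(G)| ≥ 2k − 2, where V_{≥s}(G) denotes the set of vertices of degree at least s and V_{≤s}(G) the set of vertices of degree at most s, then G contains k pairwise vertex-disjoint cycles. -/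
open Finset

/-- `V_{≥ s}(G)`: the set of vertices of degree at least `s`. -/
def Vge {V : Type*} [Fintype V] (G : SimpleGraph V) [DecidableRel G.Adj] (s : ℕ) : Finset V :=
  univ.filter fun v => s ≤ G.degree v

/-- `V_{≤ s}(G)`: the set of vertices of degree at most `s`. -/
def Vle {V : Type*} [Fintype V] (G : SimpleGraph V) [DecidableRel G.Adj] (s : ℕ) : Finset V :=
  univ.filter fun v => G.degree v ≤ s

namespace DisjointCycles

open Classical in
/-- The number of neighbours of `x` in `A`. -/
noncomputable def degIn {V : Type*} (G : SimpleGraph V) (A : Finset V) (x : V) : ℕ :=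
  #{y ∈ A | G.Adj x y}

/-- The sum of the degrees of the graph induced by `G` on `A`. -/
noncomputable def degSum {V : Type*} (G : SimpleGraph V) (A : Finset V) : ℕ :=
  ∑ x ∈ A, degIn G A x

/-- The graph induced by `G` on the nonempty set `A` has at least as many edges as vertices. -/
def EdgeDense {V : Type*} (G : SimpleGraph V) (A : Finset V) : Prop :=
  A.Nonempty ∧ 2 * #A ≤ degSum G A

/-- `G` has no triangle with all vertices in `A`. -/
def TriangleFreeOn {V : Type*} (G : SimpleGraph V) (A : Finset V) : Prop :=
  ∀ x ∈ A, ∀ y ∈ A, ∀ z ∈ A, G.Adj x y → G.Adj y z → ¬ G.Adj x z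

/-- `A` contains `k` pairwise disjoint dense sets. -/
def HasDisjointDense {V : Type*} (G : SimpleGraph V) (A : Finset V) (k : ℕ) : Prop :=
  ∃ f : Fin k → Finset V, (∀ i, f i ⊆ A) ∧ (∀ i, EdgeDense G (f i)) ∧
    ∀ i j, i ≠ j → Disjoint (f i) (f j)

section DegreeSums

variable {V : Type*} {G : SimpleGraph V} {A B : Finset V} {b x : V}

open Classical in
lemma degIn_erase [DecidableEq V] (hb : b ∈ A) (x : V) :
    degIn G A x = degIn G (A.erase b) x + if G.Adj x b then 1 else 0 := by
  conv_lhs => rw [← insert_erase hb]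
  simp only [degIn, filter_insert]
  split_ifs with h
  · rw [card_insert_of_notMem (by simp)]
  · simp

lemma degIn_erase_self [DecidableEq V] (b : V) : degIn G (A.erase b) b = degIn G A b := by
  classical
  by_cases hb : b ∈ A
  · simp [degIn_erase hb]
  · rw [erase_eq_of_notMem hb]

lemma degIn_mono (h : B ⊆ A) (x : V) : degIn G B x ≤ degIn G A x := by
  classical
  exact card_le_card (filter_subset_filter _ h)

lemma degIn_sdiff [DecidableEq V] (h : B ⊆ A) (x : V) :
    degIn G (A \ B) x + degIn G B x = degIn G A x := by
  classical
  unfold degIn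
  rw [← card_union_of_disjoint (disjoint_filter_filter sdiff_disjoint), ← filter_union,
    sdiff_union_of_subset h]

lemma degSum_erase [DecidableEq V] (hb : b ∈ A) :
    degSum G A = degSum G (A.erase b) + 2 * degIn G A b := by
  classical
  have hs : ∑ x ∈ A.erase b, (if G.Adj x b then 1 else 0) = degIn G A b := by
    rw [← degIn_erase_self, degIn, card_filter]
    exact sum_congr rfl fun x _ => by simp [G.adj_comm]
  unfold degSum
  rw [← add_sum_erase A _ hb, sum_congr rfl fun x _ => degIn_erase hb x, sum_add_distrib, hs]
  ring

lemma even_degSum (A : Finset V) : Even (degSum G A) := by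
  classical
  induction A using Finset.induction_on with
  | empty => simp [degSum]
  | insert b A hb ih =>
    rw [degSum_erase (mem_insert_self b A), erase_insert hb]
    exact ih.add (even_two_mul _)

lemma edgeDense_of_two_le_degIn (hA : A.Nonempty) (h : ∀ x ∈ A, 2 ≤ degIn G A x) :
    EdgeDense G A := by
  refine ⟨hA, ?_⟩
  have := card_nsmul_le_sum A (degIn G A) 2 h
  simp only [smul_eq_mul] at this
  exact (mul_comm _ _).trans_le this

lemma degIn_lt_card (hx : x ∈ A) : degIn G A x < #A := by
  classical
  rw [← degIn_erase_self]
  exact (card_filter_le _ _).trans_lt (card_erase_lt_of_mem hx)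

lemma EdgeDense.one_lt_card (h : EdgeDense G A) : 1 < #A := by
  by_contra! hc
  have h0 : ∀ x ∈ A, degIn G A x = 0 := fun x hx => by
    have := degIn_lt_card (G := G) hx
    omega
  have h1 := h.2
  have h2 := h.1.card_pos
  rw [degSum, sum_eq_zero h0] at h1
  omega

lemma degIn_eq_two_of_minimal (hA : Minimal (EdgeDense G) A) (hx : x ∈ A) : degIn G A x = 2 := by
  classical
  have herase : ∀ b ∈ A, degSum G A < 2 * (#A - 1) + 2 * degIn G A b := by
    intro b hb
    by_contra! hc
    refine (erase_ssubset hb).not_subset (hA.2 (y := A.erase b) ⟨?_, ?_⟩ (erase_subset _ _))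
    · rw [← card_pos, card_erase_of_mem hb]
      have := hA.1.one_lt_card
      omega
    · rw [card_erase_of_mem hb]
      have := degSum_erase (G := G) hb
      omega
  have hcard := hA.1.one_lt_card
  have hsum := hA.1.2
  have hge : ∀ b ∈ A, 2 ≤ degIn G A b := fun b hb => by
    have := herase b hb
    omega
  have hle : degSum G A ≤ 2 * #A := by
    obtain ⟨b, hb, hmin⟩ := exists_min_image A (degIn G A) hA.1.1
    have h1 := herase b hb
    obtain ⟨e, he⟩ := even_degSum (G := G) A
    rcases (hge b hb).eq_or_lt with h2 | h2
    · omega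
    · have h3 := card_nsmul_le_sum A (degIn G A) _ hmin
      have h4 := degIn_lt_card (G := G) hb
      rw [smul_eq_mul] at h3
      change _ ≤ degSum G A at h3
      have h5 : #A * degIn G A b < 2 * (#A - 1) + 2 * degIn G A b := h3.trans_lt h1
      obtain ⟨c, hc⟩ := Nat.exists_eq_add_of_lt h4
      obtain ⟨d, hd⟩ := Nat.exists_eq_add_of_lt h2
      rw [hc, hd] at h5
      have h6 : 2 + d + 1 + c + 1 - 1 = 3 + d + c := by omega
      rw [h6] at h5
      nlinarith [Nat.zero_le (d * c), Nat.zero_le (d * d)]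
  refine le_antisymm ?_ (hge x hx)
  have h1 : ∑ y ∈ A.erase x, 2 ≤ ∑ y ∈ A.erase x, degIn G A y :=
    sum_le_sum fun y hy => hge y (mem_of_mem_erase hy)
  have h2 : degIn G A x + ∑ y ∈ A.erase x, degIn G A y = degSum G A := add_sum_erase A _ hx
  rw [sum_const, card_erase_of_mem hx, smul_eq_mul] at h1
  omega

lemma EdgeDense.exists_minimal (h : EdgeDense G A) : ∃ B ⊆ A, Minimal (EdgeDense G) B :=
  exists_minimal_le_of_wellFoundedLT (EdgeDense G) A h

/-- In a triangle-free graph, a vertex outside a smallest dense set has at most two neighbours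
in it. -/
lemma degIn_le_two (htf : TriangleFreeOn G A) (hBA : B ⊆ A) (hB : EdgeDense G B)
    (hmin : ∀ C ⊆ A, EdgeDense G C → #B ≤ #C) (hx : x ∈ A) : degIn G B x ≤ 2 := by
  classical
  have hBmin : Minimal (EdgeDense G) B :=
    ⟨hB, fun C hC hCB => (eq_of_subset_of_card_le hCB (hmin C (hCB.trans hBA) hC)).ge⟩
  have htwo : ∀ b ∈ B, degIn G B b = 2 := fun b hb => degIn_eq_two_of_minimal hBmin hb
  by_cases hxB : x ∈ B
  · exact (htwo x hxB).le
  by_contra! h3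
  obtain ⟨b, hb⟩ := card_pos.mp (show 0 < #{y ∈ B | G.Adj x y} from (by omega : 0 < degIn G B x))
  obtain ⟨hbB, hxb⟩ := mem_filter.mp hb
  have hb2 := htwo b hbB
  obtain ⟨p, hp⟩ := card_pos.mp (show 0 < #{y ∈ B | G.Adj b y} by
    rw [← degIn, hb2]; omega)
  obtain ⟨hpB, hbp⟩ := mem_filter.mp hp
  have hp2 := htwo p hpB
  have hxp : ¬ G.Adj x p := htf x hx b (hBA hbB) p (hBA hpB) hxb hbp
  have hxI : x ∈ insert x B := mem_insert_self _ _
  have hbI : b ∈ insert x B := mem_insert_of_mem hbB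
  have hpI : p ∈ (insert x B).erase b := mem_erase.2 ⟨hbp.ne', mem_insert_of_mem hpB⟩
  have e0 := degSum_erase (G := G) hxI
  have e0' := degIn_erase_self (G := G) (A := insert x B) x
  have e1 := degSum_erase (G := G) hbI
  have e2 := degSum_erase (G := G) hpI
  have d1 := degIn_erase (G := G) hxI b
  have d2 := degIn_erase (G := G) hxI p
  have d3 := degIn_erase (G := G) hbI p
  rw [erase_insert hxB] at e0 e0' d1 d2
  rw [if_pos hxb.symm] at d1
  rw [if_neg fun h => hxp h.symm] at d2
  rw [if_pos hbp.symm] at d3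
  have hcard : #(((insert x B).erase b).erase p) = #B - 1 := by
    rw [card_erase_of_mem hpI, card_erase_of_mem hbI, card_insert_of_notMem hxB]
    omega
  have hone := hB.one_lt_card
  have hsum := hB.2
  have hsub : ((insert x B).erase b).erase p ⊆ A :=
    ((erase_subset _ _).trans (erase_subset _ _)).trans (insert_subset hx hBA)
  have := hmin (((insert x B).erase b).erase p) hsub
    ⟨card_pos.mp (by omega), by omega⟩
  omega

end DegreeSums

section Cycles

variable {V : Type*} {G : SimpleGraph V} {A : Finset V}

lemma exists_subsingleton_neighbors_of_isAcyclic {W : Type*} [Finite W] [Nonempty W]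
    {H : SimpleGraph W} (hH : H.IsAcyclic) :
    ∃ u, ∀ w w', H.Adj u w → H.Adj u w' → w = w' := by
  classical
  have := Fintype.ofFinite W
  let S : Set ℕ := {n | ∃ u v, ∃ p : H.Walk u v, p.IsPath ∧ p.length = n}
  have hfin : S.Finite := (Set.finite_lt_nat (Fintype.card W)).subset <| by
    rintro n ⟨u, v, p, hp, rfl⟩
    exact hp.length_lt
  obtain ⟨w₀⟩ := ‹Nonempty W›
  have hne : S.Nonempty := ⟨0, w₀, w₀, .nil, by simp⟩
  obtain ⟨n, ⟨u, v, p, hp, rfl⟩, hmax⟩ := hfin.exists_maximal hne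
  have hsnd : ∀ w, H.Adj u w → w = p.snd := by
    intro w hw
    by_cases hmem : w ∈ p.support
    · exact hH.eq_snd_of_adj_start hp hw hmem
    · have := hmax (y := p.length + 1)
        ⟨w, v, .cons hw.symm p, (SimpleGraph.Walk.cons_isPath_iff _ _).2 ⟨hp, hmem⟩, rfl⟩
        (Nat.le_succ _)
      omega
  exact ⟨u, fun w w' hw hw' => (hsnd w hw).trans (hsnd w' hw').symm⟩

lemma EdgeDense.exists_isCycle (h : EdgeDense G A) :
    ∃ (v : V) (c : G.Walk v v), c.IsCycle ∧ ∀ x ∈ c.support, x ∈ A := by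
  classical
  obtain ⟨B, hBA, hB⟩ := h.exists_minimal
  have hcyc : ¬ (G.induce (B : Set V)).IsAcyclic := by
    intro hac
    have : Nonempty (B : Set V) := hB.1.1.to_subtype
    obtain ⟨u, hu⟩ := exists_subsingleton_neighbors_of_isAcyclic hac
    have h2 := degIn_eq_two_of_minimal hB (mem_coe.mp u.2)
    obtain ⟨y, hy, z, hz, hyz⟩ := Finset.one_lt_card.mp
      (show 1 < #{y ∈ B | G.Adj u y} by rw [← degIn, h2]; omega)
    rw [mem_filter] at hy hz
    exact hyz (congrArg Subtype.val (hu ⟨y, hy.1⟩ ⟨z, hz.1⟩ hy.2 hz.2))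
  simp only [SimpleGraph.IsAcyclic, not_forall, not_not] at hcyc
  obtain ⟨v, c, hc⟩ := hcyc
  refine ⟨_, c.map (SimpleGraph.Embedding.induce (B : Set V)).toHom,
    hc.map Subtype.val_injective, fun x hx => ?_⟩
  rw [SimpleGraph.Walk.support_map, List.mem_map] at hx
  obtain ⟨y, -, rfl⟩ := hx
  exact hBA y.2

lemma HasDisjointDense.hasDisjointCycles {k : ℕ} (h : HasDisjointDense G A k) :
    HasDisjointCycles G k := by
  obtain ⟨f, -, hf, hdisj⟩ := h
  choose v c hc hsupp using fun i => (hf i).exists_isCycle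
  exact ⟨v, c, hc, fun i j hij x hi hj =>
    disjoint_left.mp (hdisj i j hij) (hsupp i x hi) (hsupp j x hj)⟩

end Cycles

section Minimum

variable {V : Type*} {G : SimpleGraph V} {A B : Finset V}

lemma HasDisjointDense.mono {k : ℕ} (h : HasDisjointDense G B k) (hBA : B ⊆ A) :
    HasDisjointDense G A k := by
  obtain ⟨f, hf, h'⟩ := h
  exact ⟨f, fun i => (hf i).trans hBA, h'⟩

lemma hasDisjointDense_zero : HasDisjointDense G A 0 :=
  ⟨fun i => i.elim0, fun i => i.elim0, fun i => i.elim0, fun i => i.elim0⟩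

lemma HasDisjointDense.succ [DecidableEq V] {k : ℕ} (h : HasDisjointDense G (A \ B) k)
    (hBA : B ⊆ A) (hB : EdgeDense G B) : HasDisjointDense G A (k + 1) := by
  obtain ⟨f, hf, hd, hdisj⟩ := h
  have hfB : ∀ i, Disjoint B (f i) := fun i => disjoint_sdiff.mono_right (hf i)
  refine ⟨Fin.cons B f, ?_, ?_, ?_⟩
  · exact Fin.cases hBA fun i => (hf i).trans sdiff_subset
  · exact Fin.cases hB hd
  · refine Fin.cases (Fin.cases (by simp) fun j _ => hfB j) fun i =>
      Fin.cases (fun _ => (hfB i).symm) fun j hij => ?_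
    exact hdisj i j fun h => hij (by rw [h])

lemma TriangleFreeOn.mono (h : TriangleFreeOn G A) (hBA : B ⊆ A) : TriangleFreeOn G B :=
  fun x hx y hy z hz => h x (hBA hx) y (hBA hy) z (hBA hz)

/-- A Corrádi–Hajnal type theorem for triangle-free graphs. -/
lemma hasDisjointDense_of_le_degIn (k : ℕ) (A : Finset V) (hne : A.Nonempty)
    (htf : TriangleFreeOn G A) (hdeg : ∀ x ∈ A, 2 * k ≤ degIn G A x) :
    HasDisjointDense G A k := by
  classical
  induction k generalizing A with
  | zero => exact hasDisjointDense_zero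
  | succ k ih =>
    have hA : EdgeDense G A := edgeDense_of_two_le_degIn hne fun x hx => by
      have := hdeg x hx
      omega
    obtain ⟨B, hB, hmin⟩ := exists_min_image (A.powerset.filter (EdgeDense G)) card
      ⟨A, by simp [hA]⟩
    rw [mem_filter, mem_powerset] at hB
    obtain ⟨hBA, hB⟩ := hB
    refine HasDisjointDense.succ ?_ hBA hB
    rcases k.eq_zero_or_pos with rfl | hk
    · exact hasDisjointDense_zero
    have hle : ∀ x ∈ A, degIn G B x ≤ 2 := fun x hx =>
      degIn_le_two htf hBA hB (fun C hCA hC => hmin C (by simp [hCA, hC])) hx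
    refine ih _ ?_ (htf.mono sdiff_subset) fun x hx => ?_
    · rw [sdiff_nonempty]
      intro hAB
      obtain ⟨x, hx⟩ := hne
      have h1 := hdeg x hx
      have h2 := hle x hx
      have h3 := degIn_mono (G := G) hAB x
      omega
    · have hxA := (mem_sdiff.mp hx).1
      have h1 := hdeg x hxA
      have h2 := hle x hxA
      have h3 := degIn_sdiff (G := G) hBA x
      omega

end Minimum

section Contraction

variable {V : Type*} {G : SimpleGraph V} {A B : Finset V} {u v x : V}

/-- The graph obtained from `G` by letting `v` absorb the neighbours of `u`. When `u` and `v` are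
adjacent, deleting `u` from it gives the contraction of the edge `uv`. -/
def absorb (G : SimpleGraph V) (u v : V) : SimpleGraph V where
  Adj x y := x ≠ y ∧ (G.Adj x y ∨ x = v ∧ G.Adj u y ∨ y = v ∧ G.Adj u x)
  symm := ⟨fun x y h => ⟨h.1.symm, by have := h.2; rw [G.adj_comm]; tauto⟩⟩

lemma absorb_adj_of_ne {x y : V} (hx : x ≠ v) (hy : y ≠ v) :
    (absorb G u v).Adj x y ↔ G.Adj x y := by
  simp only [absorb, hx, hy, false_and, or_false]
  exact ⟨fun h => h.2, fun h => ⟨h.ne, h⟩⟩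

lemma absorb_adj_right {y : V} :
    (absorb G u v).Adj v y ↔ v ≠ y ∧ (G.Adj v y ∨ G.Adj u y) := by
  simp only [absorb]
  tauto

lemma degIn_absorb_of_notMem (hv : v ∉ B) (hx : x ≠ v) :
    degIn (absorb G u v) B x = degIn G B x := by
  classical
  unfold degIn
  congr 1
  exact filter_congr fun y hy => absorb_adj_of_ne hx fun h => hv (h ▸ hy)

lemma degSum_absorb_of_notMem (hv : v ∉ B) : degSum (absorb G u v) B = degSum G B :=
  sum_congr rfl fun _ hx => degIn_absorb_of_notMem hv fun h => hv (h ▸ hx)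

lemma degIn_absorb_self [DecidableEq V] (htf : TriangleFreeOn G A) (hu : u ∈ A) (huv : G.Adj u v)
    (hBA : B ⊆ A) (hv : v ∈ B) :
    degIn (absorb G u v) B v + 1 = degIn G B v + degIn G B u := by
  classical
  have h1 : degIn (absorb G u v) B v
      = #({y ∈ B | G.Adj v y} ∪ {y ∈ B.erase v | G.Adj u y}) := by
    unfold degIn
    congr 1
    ext y
    simp only [mem_filter, mem_union, mem_erase, absorb_adj_right]
    constructor
    · rintro ⟨hy, hne, h | h⟩
      · exact .inl ⟨hy, h⟩
      · exact .inr ⟨⟨hne.symm, hy⟩, h⟩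
    · rintro (⟨hy, h⟩ | ⟨⟨hne, hy⟩, h⟩)
      · exact ⟨hy, h.ne, .inl h⟩
      · exact ⟨hy, hne.symm, .inr h⟩
  have hdisj : Disjoint {y ∈ B | G.Adj v y} {y ∈ B.erase v | G.Adj u y} := by
    rw [disjoint_left]
    intro y hy hy'
    rw [mem_filter] at hy hy'
    exact htf u hu v (hBA hv) y (hBA hy.1) huv hy.2 hy'.2
  have h2 := degIn_erase (G := G) hv u
  rw [if_pos huv] at h2
  rw [h1, card_union_of_disjoint hdisj, h2]
  rfl

lemma degIn_absorb_of_ne [DecidableEq V] (htf : TriangleFreeOn G A) (hu : u ∈ A) (hv : v ∈ A)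
    (huv : G.Adj u v) (hx : x ∈ A) (hxv : x ≠ v) :
    degIn (absorb G u v) (A.erase u) x = degIn G A x := by
  have hv' : v ∈ A.erase u := mem_erase.2 ⟨huv.ne', hv⟩
  rw [degIn_erase hv', degIn_absorb_of_notMem (by simp) hxv, degIn_erase hu, degIn_erase hv',
    add_assoc]
  congr 1
  have h1 : (absorb G u v).Adj x v ↔ G.Adj x v ∨ G.Adj x u := by
    rw [SimpleGraph.adj_comm, absorb_adj_right, G.adj_comm x v, G.adj_comm x u]
    simp [hxv.symm]
  have h2 : G.Adj x u → ¬ G.Adj x v := fun h => htf x hx u hu v hv h huv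
  by_cases h3 : G.Adj x u <;> by_cases h4 : G.Adj x v <;> simp_all

lemma TriangleFreeOn.absorb [DecidableEq V] (htf : TriangleFreeOn G A) (hu : u ∈ A) (hv : v ∈ A)
    (huv : G.Adj u v)
    (h4 : ∀ a ∈ A, ∀ b ∈ A, ∀ c ∈ A, a ≠ b → c ≠ u → G.Adj u a → G.Adj a c → G.Adj c b →
      ¬ G.Adj b u) :
    TriangleFreeOn (absorb G u v) (A.erase u) := by
  have key : ∀ y ∈ A, ∀ z ∈ A, y ≠ u → z ≠ u → (DisjointCycles.absorb G u v).Adj v y →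
      (DisjointCycles.absorb G u v).Adj v z → ¬ (DisjointCycles.absorb G u v).Adj y z := by
    intro y hy z hz hyu hzu h1 h2 h3
    rw [absorb_adj_right] at h1 h2
    rw [absorb_adj_of_ne h1.1.symm h2.1.symm] at h3
    rcases h1 with ⟨hvy, h1 | h1⟩ <;> rcases h2 with ⟨hvz, h2 | h2⟩
    · exact htf v hv y hy z hz h1 h3 h2
    · exact h4 v hv z hz y hy hvz hyu huv h1 h3 h2.symm
    · exact h4 v hv y hy z hz hvy hzu huv h2 h3.symm h1.symm
    · exact htf u hu y hy z hz h1 h3 h2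
  intro x hx y hy z hz hxy hyz hxz
  obtain ⟨hxu, hx⟩ := mem_erase.mp hx
  obtain ⟨hyu, hy⟩ := mem_erase.mp hy
  obtain ⟨hzu, hz⟩ := mem_erase.mp hz
  by_cases hxv : x = v
  · subst hxv
    exact key y hy z hz hyu hzu hxy hxz hyz
  by_cases hyv : y = v
  · subst hyv
    exact key x hx z hz hxu hzu hxy.symm hyz hxz
  by_cases hzv : z = v
  · subst hzv
    exact key x hx y hy hxu hyu hxz.symm hyz.symm hxy
  rw [absorb_adj_of_ne ‹_› ‹_›] at hxy hyz hxz
  exact htf x hx y hy z hz hxy hyz hxz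

lemma EdgeDense.insert_of_absorb [DecidableEq V] (htf : TriangleFreeOn G A) (hu : u ∈ A)
    (huv : G.Adj u v) (hBA : B ⊆ A.erase u) (hv : v ∈ B) (hB : EdgeDense (absorb G u v) B) :
    EdgeDense G (insert u B) := by
  have huB : u ∉ B := fun h => (mem_erase.mp (hBA h)).1 rfl
  refine ⟨insert_nonempty _ _, ?_⟩
  have h1 := degSum_erase (G := G) (mem_insert_self u B)
  have h2 := degIn_erase_self (G := G) (A := insert u B) u
  have h3 := degSum_erase (G := G) hv
  have h4 := degSum_erase (G := absorb G u v) hv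
  have h5 := degIn_absorb_self htf hu huv (hBA.trans (erase_subset _ _)) hv
  have h6 := degSum_absorb_of_notMem (G := G) (u := u) (notMem_erase v B)
  have h7 := hB.2
  rw [erase_insert huB] at h1 h2
  rw [card_insert_of_notMem huB]
  omega

lemma HasDisjointDense.of_absorb [DecidableEq V] {k : ℕ} (htf : TriangleFreeOn G A) (hu : u ∈ A)
    (huv : G.Adj u v) (h : HasDisjointDense (absorb G u v) (A.erase u) k) :
    HasDisjointDense G A k := by
  obtain ⟨f, hf, hd, hdisj⟩ := h
  have huf : ∀ i, u ∉ f i := fun i h => (mem_erase.mp (hf i h)).1 rfl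
  refine ⟨fun i => if v ∈ f i then insert u (f i) else f i, fun i => ?_, fun i => ?_,
    fun i j hij => ?_⟩
  · have := (hf i).trans (erase_subset _ _)
    dsimp only
    split_ifs
    exacts [insert_subset hu this, this]
  · dsimp only
    split_ifs with hv
    · exact (hd i).insert_of_absorb htf hu huv (hf i) hv
    · exact ⟨(hd i).1, by simpa only [degSum_absorb_of_notMem hv] using (hd i).2⟩
  · have hd' := hdisj i j hij
    dsimp only
    split_ifs with hi hj hj
    · exact (disjoint_left.mp hd' hi hj).elim
    · exact disjoint_insert_left.2 ⟨huf j, hd'⟩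
    · exact disjoint_insert_right.2 ⟨huf i, hd'⟩
    · exact hd'

end Contraction

section FourCycles

variable {V : Type*} {G : SimpleGraph V} {A : Finset V} {a b c d x : V}

lemma two_le_degIn {y z : V} (hy : y ∈ A) (hz : z ∈ A) (hyz : y ≠ z) (hxy : G.Adj x y)
    (hxz : G.Adj x z) : 2 ≤ degIn G A x := by
  classical
  exact Finset.one_lt_card.2 ⟨y, by simp [hy, hxy], z, by simp [hz, hxz], hyz⟩

lemma edgeDense_of_fourCycle [DecidableEq V] (hac : a ≠ c) (hbd : b ≠ d) (hab : G.Adj a b)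
    (hbc : G.Adj b c) (hcd : G.Adj c d) (hda : G.Adj d a) : EdgeDense G {a, b, c, d} := by
  refine edgeDense_of_two_le_degIn (by simp) ?_
  simp only [mem_insert, mem_singleton]
  rintro x (rfl | rfl | rfl | rfl)
  · exact two_le_degIn (by simp) (by simp) hbd hab hda.symm
  · exact two_le_degIn (by simp) (by simp) hac hab.symm hbc
  · exact two_le_degIn (by simp) (by simp) hbd hbc.symm hcd
  · exact two_le_degIn (by simp) (by simp) hac hda hcd.symm

lemma degIn_fourCycle_le_two [DecidableEq V] (htf : TriangleFreeOn G A) (ha : a ∈ A) (hb : b ∈ A)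
    (hc : c ∈ A) (hd : d ∈ A) (hx : x ∈ A) (hab : G.Adj a b) (hbc : G.Adj b c) (hcd : G.Adj c d)
    (hda : G.Adj d a) : degIn G {a, b, c, d} x ≤ 2 := by
  classical
  unfold degIn
  by_cases h : G.Adj x a ∨ G.Adj x c
  · refine (card_le_card (t := {a, c}) fun y hy => ?_).trans card_le_two
    simp only [mem_filter, mem_insert, mem_singleton] at hy ⊢
    obtain ⟨rfl | rfl | rfl | rfl, hy⟩ := hy
    · simp
    · exact (h.elim (fun h => htf x hx a ha y hb h hab hy)
        fun h => htf x hx c hc y hb h hbc.symm hy).elim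
    · simp
    · exact (h.elim (fun h => htf x hx a ha y hd h hda.symm hy)
        fun h => htf x hx c hc y hd h hcd hy).elim
  · refine (card_le_card (t := {b, d}) fun y hy => ?_).trans card_le_two
    simp only [mem_filter, mem_insert, mem_singleton] at hy ⊢
    obtain ⟨rfl | rfl | rfl | rfl, hy⟩ := hy <;> simp_all

end FourCycles

section Weights

/-- The contribution of a vertex of degree `d` to the difference between the number of vertices
of degree at least `2 * m + 3` and the number of vertices of degree at most `2 * m + 1`. -/
def weight (m d : ℕ) : ℤ :=
  (if 2 * m + 3 ≤ d then 1 else 0) - if d ≤ 2 * m + 1 then 1 else 0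

lemma weight_le_one (m d : ℕ) : weight m d ≤ 1 := by
  unfold weight
  split_ifs <;> omega

lemma weight_of_le {m d : ℕ} (h : d ≤ 2 * m + 1) : weight m d = -1 := by
  unfold weight
  split_ifs <;> omega

lemma weight_le_add_one {m d e : ℕ} (h : d ≤ e + 1) : weight m d ≤ weight m e + 1 := by
  unfold weight
  split_ifs <;> omega

lemma weight_succ_le {m d e : ℕ} (h : d ≤ e + 2) : weight (m + 1) d ≤ weight m e := by
  unfold weight
  split_ifs <;> omega

variable {V : Type*}

theorem hasDisjointDense_of_le_sum_weight (m : ℕ) (G : SimpleGraph V) (A : Finset V)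
    (hne : A.Nonempty) (htf : TriangleFreeOn G A)
    (hw : (2 * m : ℤ) ≤ ∑ x ∈ A, weight m (degIn G A x)) : HasDisjointDense G A (m + 1) := by
  classical
  induction m using Nat.strong_induction_on generalizing G A with | _ m ihm =>
  induction A using Finset.strongInduction generalizing G with | _ A ihA =>
  by_cases hlow : ∃ u ∈ A, degIn G A u ≤ 2 * m + 1
  swap
  · push Not at hlow
    exact hasDisjointDense_of_le_degIn _ A hne htf fun x hx => hlow x hx
  obtain ⟨u, hu, hdu⟩ := hlow
  have hwu := weight_of_le hdu
  have hwA := add_sum_erase A (fun x => weight m (degIn G A x)) hu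
  by_cases h4 : ∀ a ∈ A, ∀ b ∈ A, ∀ c ∈ A, a ≠ b → c ≠ u → G.Adj u a → G.Adj a c →
      G.Adj c b → ¬ G.Adj b u
  swap
  · push Not at h4
    obtain ⟨a, ha, b, hb, c, hc, hab, hcu, hua, hac, hcb, hbu⟩ := h4
    have hCA : {u, a, c, b} ⊆ A := by simp [insert_subset_iff, *]
    have hC := edgeDense_of_fourCycle hcu.symm hab hua hac hcb hbu
    have hCle : ∀ x ∈ A, degIn G {u, a, c, b} x ≤ 2 := fun x hx =>
      degIn_fourCycle_le_two htf hu ha hc hb hx hua hac hcb hbu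
    refine HasDisjointDense.succ ?_ hCA hC
    rcases m with _ | m
    · exact hasDisjointDense_zero
    refine ihm m (Nat.lt_succ_self m) G _ ?_ (htf.mono sdiff_subset) ?_
    · rw [sdiff_nonempty]
      intro hAC
      have h0 : ∑ x ∈ A, weight (m + 1) (degIn G A x) ≤ 0 := sum_nonpos fun x hx => by
        have h1 := hCle x hx
        have h2 := degIn_mono (G := G) hAC x
        rw [weight_of_le (by omega)]
        norm_num
      push_cast at hw
      linarith
    · have h1 : ∑ x ∈ A \ {u, a, c, b}, weight (m + 1) (degIn G A x)
          ≤ ∑ x ∈ A \ {u, a, c, b}, weight m (degIn G (A \ {u, a, c, b}) x) :=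
        sum_le_sum fun x hx => weight_succ_le <| by
          have h2 := hCle x (mem_sdiff.mp hx).1
          have h3 := degIn_sdiff (G := G) hCA x
          omega
      have h2 : ∑ x ∈ {a, c, b}, weight (m + 1) (degIn G A x) ≤ 3 := by
        refine (sum_le_card_nsmul _ _ 1 fun x _ => weight_le_one _ _).trans ?_
        have : #{a, c, b} ≤ 3 := card_le_three
        simpa using this
      have h3 := sum_sdiff (f := fun x => weight (m + 1) (degIn G A x)) hCA
      rw [sum_insert (by simp [hua.ne, hcu.symm, hbu.ne'])] at h3
      push_cast at hw
      linarith
  by_cases hiso : ∃ v ∈ A, G.Adj u v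
  · obtain ⟨v, hv, huv⟩ := hiso
    have hv' : v ∈ A.erase u := mem_erase.2 ⟨huv.ne', hv⟩
    refine HasDisjointDense.of_absorb htf hu huv <|
      ihA _ (erase_ssubset hu) _ ⟨v, hv'⟩ (htf.absorb hu hv huv h4) ?_
    have h1 : ∑ x ∈ (A.erase u).erase v, weight m (degIn (absorb G u v) (A.erase u) x)
        = ∑ x ∈ (A.erase u).erase v, weight m (degIn G A x) :=
      sum_congr rfl fun x hx => by
        rw [mem_erase, mem_erase] at hx
        rw [degIn_absorb_of_ne htf hu hv huv hx.2.2 hx.1]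
    have h2 : weight m (degIn G A v) ≤ weight m (degIn (absorb G u v) (A.erase u) v) + 1 :=
      weight_le_add_one <| by
        have h3 := degIn_absorb_self htf hu huv (erase_subset u A) hv'
        have h4 := degIn_erase (G := G) hu v
        have h5 := degIn_erase_self (G := G) (A := A) u
        have h6 := degIn_erase (G := G) hv u
        rw [if_pos huv.symm] at h4
        rw [if_pos huv] at h6
        omega
    have h3 := add_sum_erase (A.erase u) (fun x => weight m (degIn G A x)) hv'
    rw [← add_sum_erase _ _ hv', h1]
    linarith
  · push Not at hiso
    refine (ihA _ (erase_ssubset hu) G ?_ (htf.mono (erase_subset _ _)) ?_).mono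
      (erase_subset _ _)
    · rw [nonempty_iff_ne_empty]
      intro h0
      rw [h0, sum_empty] at hwA
      linarith
    · have h1 : ∑ x ∈ A.erase u, weight m (degIn G (A.erase u) x)
          = ∑ x ∈ A.erase u, weight m (degIn G A x) :=
        sum_congr rfl fun x hx => by
          rw [degIn_erase hu x, if_neg fun h => hiso x (mem_of_mem_erase hx) h.symm, add_zero]
      rw [h1]
      linarith

end Weights

end DisjointCycles

theorem triangle_free_degree_version {V : Type*} [Fintype V] (G : SimpleGraph V)
    [DecidableRel G.Adj] (k : ℕ) (hk : 0 < k) (hne : Nonempty V) (htf : G.CliqueFree 3)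
    (hHL : (Vle G (2 * k - 1)).card + (2 * k - 2) ≤ (Vge G (2 * k + 1)).card) :
    HasDisjointCycles G k := by
  classical
  obtain ⟨m, rfl⟩ := Nat.exists_eq_add_of_lt hk
  rw [zero_add] at hHL ⊢
  have hdeg : ∀ x, DisjointCycles.degIn G univ x = G.degree x := fun x => by
    rw [DisjointCycles.degIn, ← G.card_neighborFinset_eq_degree, G.neighborFinset_eq_filter]
    congr!
  refine DisjointCycles.HasDisjointDense.hasDisjointCycles <|
    DisjointCycles.hasDisjointDense_of_le_sum_weight m G univ univ_nonempty ?_ ?_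
  · intro x _ y _ z _ hxy hyz hxz
    exact htf {x, y, z} (SimpleGraph.is3Clique_triple_iff.2 ⟨hxy, hxz, hyz⟩)
  · simp only [DisjointCycles.weight, hdeg, sum_sub_distrib, ← natCast_card_filter]
    change (2 * m : ℤ) ≤ (#(Vge G (2 * m + 3)) : ℤ) - #(Vle G (2 * m + 1))
    rw [show 2 * (m + 1) - 1 = 2 * m + 1 by omega, show 2 * (m + 1) + 1 = 2 * m + 3 by ring]
      at hHL
    omega
end
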